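/- For d ≥ 3, 1 ≤ r < d/2, |q| < 1: 𝒞_{d,r}(q) = (-q^r; q^d)_∞ (-q^{d-r}; q^d)_∞ · g₃(-q^r; q^d), where g₃ is the universal mock theta function. -/

import Mathlib

open scoped BigOperators

/-- The finite q-Pochhammer symbol `(a; q)_n`. -/
noncomputable def qPoch (a q : ℂ) (n : ℕ) : ℂ := ∏ j ∈ Finset.range n, (1 - a * q ^ j)

/-- The infinite q-Pochhammer symbol `(a; q)_∞`. -/
noncomputable def qPochInf (a q : ℂ) : ℂ := ∏' j : ℕ, (1 - a * q ^ j)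

/-- Hickerson's universal mock theta function
`g₃(x;q) = Σ_{n≥0} q^{n(n+1)} / ((x;q)_{n+1} (x⁻¹q;q)_{n+1})`. -/
noncomputable def g3 (x q : ℂ) : ℂ :=
  ∑' n : ℕ, q ^ (n * (n + 1)) / (qPoch x q (n + 1) * qPoch (x⁻¹ * q) q (n + 1))

/-- A Schur-type partition for parameters `d, r`. -/
def IsSchurPartition (d r : ℕ) (l : List ℕ) : Prop :=
  (∀ x ∈ l, 0 < x ∧ (x % d = 0 ∨ x % d = r ∨ x % d = d - r)) ∧
    l.Chain' (fun a b => b + d ≤ a ∧ (d ∣ a → b + d < a))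

/-- `C_{d,r}(n)`: the number of Schur-type partitions of `n` with smallest part `> d`. -/
noncomputable def schurC (d r n : ℕ) : ℕ :=
  Set.ncard {l : List ℕ | IsSchurPartition d r l ∧ (∀ x ∈ l, d < x) ∧ l.sum = n}

/-- The generating function `𝒞_{d,r}(q) = Σ_{n≥0} C_{d,r}(n) q^n`. -/
noncomputable def schurCGen (d r : ℕ) (q : ℂ) : ℂ := ∑' n : ℕ, (schurC d r n : ℂ) * q ^ n

open Filter Topology

section QSeries

variable {a b q x : ℂ}

lemma qPoch_succ (a q : ℂ) (n : ℕ) : qPoch a q (n + 1) = qPoch a q n * (1 - a * q ^ n) :=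
  Finset.prod_range_succ _ _

lemma qPoch_zero (a q : ℂ) : qPoch a q 0 = 1 := Finset.prod_range_zero _

lemma qPoch_succ' (a q : ℂ) (n : ℕ) : qPoch a q (n + 1) = (1 - a) * qPoch (a * q) q n := by
  rw [qPoch, Finset.prod_range_succ', mul_comm, qPoch]
  simp only [pow_zero, mul_one, pow_succ', mul_assoc]

lemma summable_norm_mul_pow (a : ℂ) (hq : ‖q‖ < 1) : Summable fun j : ℕ => ‖-(a * q ^ j)‖ := by
  simp only [norm_neg, norm_mul, norm_pow]
  exact (summable_geometric_of_lt_one (norm_nonneg q) hq).mul_left _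

lemma multipliable_qPoch (a : ℂ) (hq : ‖q‖ < 1) : Multipliable fun j : ℕ => 1 - a * q ^ j := by
  simpa only [sub_eq_add_neg] using multipliable_one_add_of_summable (summable_norm_mul_pow a hq)

lemma tendsto_qPoch (a : ℂ) (hq : ‖q‖ < 1) :
    Tendsto (qPoch a q) atTop (𝓝 (qPochInf a q)) :=
  (multipliable_qPoch a hq).tendsto_prod_tprod_nat

lemma qPoch_mul_qPochInf (a : ℂ) (hq : ‖q‖ < 1) (n : ℕ) :
    qPoch a q n * qPochInf (a * q ^ n) q = qPochInf a q := by
  have h : ∀ j : ℕ, 1 - a * q ^ n * q ^ j = 1 - a * q ^ (j + n) := fun j => by ring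
  have hm : Multipliable fun j : ℕ => 1 - a * q ^ (j + n) :=
    (multipliable_qPoch (a * q ^ n) hq).congr h
  rw [qPochInf, tprod_congr h]
  exact hm.prod_mul_tprod_nat_mul' (f := fun j : ℕ => 1 - a * q ^ j)

lemma qPochInf_eq_mul (a : ℂ) (hq : ‖q‖ < 1) :
    qPochInf a q = (1 - a) * qPochInf (a * q) q := by
  rw [← qPoch_mul_qPochInf a hq 1, qPoch_succ, qPoch_zero]; simp

lemma norm_qPoch_sub_one_le (a : ℂ) (hq : ‖q‖ < 1) (n : ℕ) :
    ‖qPoch a q n - 1‖ ≤ Real.exp (‖a‖ * (1 - ‖q‖)⁻¹) - 1 := by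
  have h := Finset.norm_prod_one_add_sub_one_le (Finset.range n) fun j => -(a * q ^ j)
  simp only [← sub_eq_add_neg] at h
  refine h.trans (sub_le_sub_right (Real.exp_le_exp.2 ?_) _)
  refine ((summable_norm_mul_pow a hq).sum_le_tsum _ fun _ _ => norm_nonneg _).trans_eq ?_
  simp only [norm_neg, norm_mul, norm_pow]
  rw [tsum_mul_left, tsum_geometric_of_lt_one (norm_nonneg q) hq]

lemma norm_qPochInf_sub_one_le (a : ℂ) (hq : ‖q‖ < 1) :
    ‖qPochInf a q - 1‖ ≤ Real.exp (‖a‖ * (1 - ‖q‖)⁻¹) - 1 :=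
  le_of_tendsto ((tendsto_qPoch a hq).sub_const 1).norm
    (Eventually.of_forall fun n => norm_qPoch_sub_one_le a hq n)

lemma norm_qPoch_le (ha : ‖a‖ ≤ 1) (hq : ‖q‖ < 1) (n : ℕ) :
    ‖qPoch a q n‖ ≤ Real.exp (1 - ‖q‖)⁻¹ := by
  have h1 := norm_qPoch_sub_one_le a hq n
  have h2 : ‖qPoch a q n‖ ≤ ‖qPoch a q n - 1‖ + ‖(1 : ℂ)‖ := norm_le_norm_sub_add _ _
  have h3 : Real.exp (‖a‖ * (1 - ‖q‖)⁻¹) ≤ Real.exp (1 - ‖q‖)⁻¹ :=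
    Real.exp_le_exp.2 (mul_le_of_le_one_left (inv_nonneg.2 (sub_nonneg.2 hq.le)) ha)
  rw [norm_one] at h2
  linarith

lemma norm_qPochInf_le (ha : ‖a‖ ≤ 1) (hq : ‖q‖ < 1) :
    ‖qPochInf a q‖ ≤ Real.exp (1 - ‖q‖)⁻¹ :=
  le_of_tendsto (tendsto_qPoch a hq).norm (Eventually.of_forall fun n => norm_qPoch_le ha hq n)

lemma tendsto_qPochInf_mul_pow (a : ℂ) (hq : ‖q‖ < 1) :
    Tendsto (fun n : ℕ => qPochInf (a * q ^ n) q) atTop (𝓝 1) := by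
  have h0 : Tendsto (fun n : ℕ => a * q ^ n) atTop (𝓝 0) := by
    simpa using (tendsto_pow_atTop_nhds_zero_of_norm_lt_one hq).const_mul a
  have h1 : Tendsto (fun n : ℕ => Real.exp (‖a * q ^ n‖ * (1 - ‖q‖)⁻¹) - 1) atTop (𝓝 0) := by
    have := ((Real.continuous_exp.tendsto _).comp
      (h0.norm.mul_const ((1 - ‖q‖)⁻¹))).sub_const 1
    simpa using this
  rw [tendsto_iff_norm_sub_tendsto_zero]
  exact squeeze_zero (fun _ => norm_nonneg _) (fun n => norm_qPochInf_sub_one_le _ hq) h1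

lemma norm_mul_pow_le_one (ha : ‖a‖ ≤ 1) (hq : ‖q‖ < 1) (n : ℕ) : ‖a * q ^ n‖ ≤ 1 := by
  rw [norm_mul, norm_pow]
  exact mul_le_one₀ ha (by positivity) (pow_le_one₀ (norm_nonneg _) hq.le)

/-- The coefficients of `(q; q)_∞ * ₂φ₁(a, b; 0; q, x)` as a power series in `x`. -/
noncomputable def heineCoeff (a b q : ℂ) (n : ℕ) : ℂ :=
  qPoch a q n * qPoch b q n * qPochInf (q * q ^ n) q

/-- The series `(q; q)_∞ * ₂φ₁(a, b; 0; q, x)`. -/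
noncomputable def heineSeries (a b q x : ℂ) : ℂ := ∑' n : ℕ, heineCoeff a b q n * x ^ n

lemma norm_heineCoeff_le (ha : ‖a‖ ≤ 1) (hb : ‖b‖ ≤ 1) (hq : ‖q‖ < 1) (n : ℕ) :
    ‖heineCoeff a b q n‖ ≤ Real.exp (1 - ‖q‖)⁻¹ ^ 3 := by
  rw [heineCoeff, norm_mul, norm_mul, pow_succ, sq]
  gcongr
  · exact norm_qPoch_le ha hq n
  · exact norm_qPoch_le hb hq n
  · exact norm_qPochInf_le (norm_mul_pow_le_one hq.le hq n) hq

lemma heineCoeff_succ (a b : ℂ) (hq : ‖q‖ < 1) (n : ℕ) :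
    heineCoeff a b q (n + 1) * (1 - q ^ (n + 1)) =
      heineCoeff a b q n * ((1 - a * q ^ n) * (1 - b * q ^ n)) := by
  have h := qPochInf_eq_mul (q * q ^ n) hq
  rw [show q * q ^ n * q = q * q ^ (n + 1) by ring] at h
  rw [heineCoeff, heineCoeff, h, qPoch_succ, qPoch_succ]
  ring

lemma norm_heineCoeff_mul_pow_le (ha : ‖a‖ ≤ 1) (hb : ‖b‖ ≤ 1) (hq : ‖q‖ < 1) (n : ℕ) :
    ‖heineCoeff a b q n * x ^ n‖ ≤ Real.exp (1 - ‖q‖)⁻¹ ^ 3 * ‖x‖ ^ n := by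
  rw [norm_mul, norm_pow]
  exact mul_le_mul_of_nonneg_right (norm_heineCoeff_le ha hb hq n) (by positivity)

lemma summable_heine (ha : ‖a‖ ≤ 1) (hb : ‖b‖ ≤ 1) (hq : ‖q‖ < 1) (hx : ‖x‖ < 1) :
    Summable fun n : ℕ => heineCoeff a b q n * x ^ n :=
  .of_norm_bounded ((summable_geometric_of_lt_one (norm_nonneg x) hx).mul_left _)
    (norm_heineCoeff_mul_pow_le ha hb hq)

lemma heineSeries_rec (ha : ‖a‖ ≤ 1) (hb : ‖b‖ ≤ 1) (hq : ‖q‖ < 1) (hx : ‖x‖ < 1) :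
    (1 - x) * heineSeries a b q x = (1 - x * (a + b)) * heineSeries a b q (x * q) +
      x * (a * b) * heineSeries a b q (x * q ^ 2) := by
  have hx1 : ‖x * q‖ < 1 := by
    rw [norm_mul]; exact mul_lt_one_of_nonneg_of_lt_one_left (norm_nonneg _) hx hq.le
  have hx2 : ‖x * q ^ 2‖ < 1 := by
    rw [norm_mul, norm_pow]
    exact mul_lt_one_of_nonneg_of_lt_one_left (norm_nonneg _) hx
      (pow_le_one₀ (norm_nonneg _) hq.le)
  have s0 := summable_heine ha hb hq hx
  have s1 := summable_heine ha hb hq hx1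
  have s2 := summable_heine ha hb hq hx2
  have e1 : heineSeries a b q x - heineSeries a b q (x * q) =
      ∑' n : ℕ, heineCoeff a b q (n + 1) * (1 - q ^ (n + 1)) * x ^ (n + 1) := by
    rw [heineSeries, heineSeries, ← s0.tsum_sub s1, (s0.sub s1).tsum_eq_zero_add]
    simp only [pow_zero, sub_self, zero_add]
    exact tsum_congr fun n => by rw [mul_pow]; ring
  have e2 : x * (heineSeries a b q x - (a + b) * heineSeries a b q (x * q) +
      a * b * heineSeries a b q (x * q ^ 2)) =
      ∑' n : ℕ, heineCoeff a b q (n + 1) * (1 - q ^ (n + 1)) * x ^ (n + 1) := by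
    rw [heineSeries, heineSeries, heineSeries, ← tsum_mul_left (a := a + b),
      ← tsum_mul_left (a := a * b), ← s0.tsum_sub (s1.mul_left _),
      ← (s0.sub (s1.mul_left _)).tsum_add (s2.mul_left _), ← tsum_mul_left]
    exact tsum_congr fun n => by rw [heineCoeff_succ a b hq, mul_pow, mul_pow, ← pow_mul]; ring
  linear_combination e1 - e2

lemma tendsto_heineSeries (ha : ‖a‖ ≤ 1) (hb : ‖b‖ ≤ 1) (hq : ‖q‖ < 1) :
    Tendsto (fun k : ℕ => heineSeries a b q (q ^ (k + 1))) atTop (𝓝 (qPochInf q q)) := by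
  have hlim : ∑' n : ℕ, heineCoeff a b q n * 0 ^ n = qPochInf q q := by
    rw [tsum_eq_single 0 fun n hn => by simp [hn]]
    simp [heineCoeff, qPoch_zero]
  rw [← hlim]
  have h0 : Tendsto (fun k : ℕ => q ^ (k + 1)) atTop (𝓝 0) :=
    (tendsto_add_atTop_iff_nat 1).2 (tendsto_pow_atTop_nhds_zero_of_norm_lt_one hq)
  refine tendsto_tsum_of_dominated_convergence
    (bound := fun n => Real.exp (1 - ‖q‖)⁻¹ ^ 3 * ‖q‖ ^ n)
    ((summable_geometric_of_lt_one (norm_nonneg q) hq).mul_left _)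
    (fun n => (h0.pow n).const_mul _) (Eventually.of_forall fun k n => ?_)
  refine (norm_heineCoeff_mul_pow_le ha hb hq n).trans ?_
  have : ‖q ^ (k + 1)‖ ≤ ‖q‖ := by
    rw [norm_pow]; exact pow_le_of_le_one (norm_nonneg _) hq.le (Nat.succ_ne_zero k)
  gcongr

lemma heineSeries_self (ha : ‖a‖ ≤ 1) (hb : ‖b‖ ≤ 1) (hq : ‖q‖ < 1) :
    heineSeries a b q q =
      qPochInf (a * q) q * qPochInf b q + b * heineSeries (a * q) b q q := by
  have haq : ‖a * q‖ ≤ 1 := by simpa using norm_mul_pow_le_one ha hq 1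
  have s0 := summable_heine ha hb hq hq
  have s1 := (summable_heine haq hb hq hq).mul_left b
  have h1 := (s0.sub s1).hasSum.tendsto_sum_nat
  have h2 : Tendsto (fun n : ℕ =>
      qPoch (a * q) q n * qPoch b q (n + 1) * qPochInf (q * q ^ n) q) atTop
      (𝓝 (qPochInf (a * q) q * qPochInf b q * 1)) :=
    ((tendsto_qPoch _ hq).mul ((tendsto_add_atTop_iff_nat 1).2 (tendsto_qPoch b hq))).mul
      (tendsto_qPochInf_mul_pow q hq)
  have h3 : ∀ n : ℕ, ∑ i ∈ Finset.range (n + 1), (heineCoeff a b q i * q ^ i -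
      b * (heineCoeff (a * q) b q i * q ^ i)) =
      qPoch (a * q) q n * qPoch b q (n + 1) * qPochInf (q * q ^ n) q := by
    intro n
    induction n with
    | zero => simp [heineCoeff, qPoch_zero, qPoch_succ]; ring
    | succ n ih =>
      have h := qPochInf_eq_mul (q * q ^ n) hq
      rw [show q * q ^ n * q = q * q ^ (n + 1) by ring] at h
      rw [Finset.sum_range_succ, ih, h, heineCoeff, heineCoeff, qPoch_succ' a q n,
        qPoch_succ b q (n + 1), qPoch_succ (a * q) q n]
      ring
  have h4 := tendsto_nhds_unique ((tendsto_add_atTop_iff_nat 1).2 h1)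
    (h2.congr fun n => (h3 n).symm)
  rw [s0.tsum_sub s1, tsum_mul_left] at h4
  rw [heineSeries, heineSeries]
  linear_combination h4

/-- The terms of `(a; q)_∞ (b; q)_∞ ∑ (a b)^n q^{n²} / ((a; q)_{n+1} (b; q)_{n+1})`. -/
noncomputable def rogersFineTerm (a b q : ℂ) (n : ℕ) : ℂ :=
  (a * b) ^ n * q ^ (n * n) * (qPochInf (a * q ^ (n + 1)) q * qPochInf (b * q ^ (n + 1)) q)

lemma norm_mul_pow_mul_pow_sq_le (b : ℂ) (ha : ‖a‖ ≤ 1) (hq : ‖q‖ < 1) (n : ℕ) :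
    ‖(a * b) ^ n * q ^ (n * n)‖ ≤ ‖b‖ ^ n := by
  rw [norm_mul, norm_pow, norm_pow, norm_mul, mul_pow, mul_right_comm]
  exact mul_le_of_le_one_left (by positivity)
    (mul_le_one₀ (pow_le_one₀ (norm_nonneg _) ha) (by positivity)
      (pow_le_one₀ (norm_nonneg _) hq.le))

lemma norm_rogersFineTerm_le (ha : ‖a‖ ≤ 1) (hb : ‖b‖ ≤ 1) (hq : ‖q‖ < 1) (n : ℕ) :
    ‖rogersFineTerm a b q n‖ ≤ ‖b‖ ^ n * Real.exp (1 - ‖q‖)⁻¹ ^ 2 := by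
  rw [rogersFineTerm, norm_mul, norm_mul (qPochInf _ _), sq]
  gcongr
  · exact norm_mul_pow_mul_pow_sq_le b ha hq n
  · exact norm_qPochInf_le (norm_mul_pow_le_one ha hq _) hq
  · exact norm_qPochInf_le (norm_mul_pow_le_one hb hq _) hq

lemma summable_rogersFineTerm (ha : ‖a‖ ≤ 1) (hb : ‖b‖ < 1) (hq : ‖q‖ < 1) :
    Summable (rogersFineTerm a b q) :=
  .of_norm_bounded ((summable_geometric_of_lt_one (norm_nonneg b) hb).mul_right _)
    (norm_rogersFineTerm_le ha hb.le hq)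

lemma tsum_rogersFineTerm_rec (ha : ‖a‖ ≤ 1) (hb : ‖b‖ < 1) (hq : ‖q‖ < 1) :
    ∑' n, rogersFineTerm a b q n =
      qPochInf (a * q) q * qPochInf b q + b * ∑' n, rogersFineTerm (a * q) b q n := by
  have haq : ‖a * q‖ ≤ 1 := by simpa using norm_mul_pow_le_one ha hq 1
  have s0 := summable_rogersFineTerm ha hb hq
  have s1 := (summable_rogersFineTerm haq hb hq).mul_left b
  have h1 := (s0.sub s1).hasSum.tendsto_sum_nat
  set s : ℕ → ℂ := fun n => (a * b) ^ n * q ^ (n * n) *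
    (qPochInf (a * q ^ (n + 1)) q * qPochInf (b * q ^ n) q) with hs
  have h2 : Tendsto s atTop (𝓝 0) := by
    have hb1 := tendsto_pow_atTop_nhds_zero_of_lt_one (norm_nonneg b) hb
    refine squeeze_zero_norm (a := fun n => ‖b‖ ^ n * Real.exp (1 - ‖q‖)⁻¹ ^ 2) (fun n => ?_)
      (by simpa using hb1.mul_const (Real.exp (1 - ‖q‖)⁻¹ ^ 2))
    rw [hs, norm_mul, norm_mul (qPochInf _ _), sq]
    gcongr
    · exact norm_mul_pow_mul_pow_sq_le b ha hq n
    · exact norm_qPochInf_le (norm_mul_pow_le_one ha hq _) hq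
    · exact norm_qPochInf_le (norm_mul_pow_le_one hb.le hq _) hq
  have h3 : ∀ n : ℕ, ∑ i ∈ Finset.range n, (rogersFineTerm a b q i -
      b * rogersFineTerm (a * q) b q i) = s 0 - s n := by
    intro n
    rw [← Finset.sum_range_sub']
    refine Finset.sum_congr rfl fun i _ => ?_
    have e1 := qPochInf_eq_mul (a * q ^ (i + 1)) hq
    have e2 := qPochInf_eq_mul (b * q ^ i) hq
    rw [mul_assoc, ← pow_succ] at e1 e2
    have e3 : a * q * q ^ (i + 1) = a * q ^ (i + 1 + 1) := by ring
    simp only [hs, rogersFineTerm]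
    rw [e3, e1, e2]
    ring
  have h4 := tendsto_nhds_unique h1 ((h2.const_sub (s 0)).congr fun n => (h3 n).symm)
  rw [s0.tsum_sub s1, tsum_mul_left] at h4
  have h5 : s 0 = qPochInf (a * q) q * qPochInf b q := by simp [hs]
  rw [h5] at h4
  linear_combination h4

lemma heineSeries_self_eq_tsum_rogersFineTerm (ha : ‖a‖ ≤ 1) (hb : ‖b‖ < 1) (hq : ‖q‖ < 1) :
    heineSeries a b q q = ∑' n, rogersFineTerm a b q n := by
  set D : ℕ → ℂ := fun k =>
    heineSeries (a * q ^ k) b q q - ∑' n, rogersFineTerm (a * q ^ k) b q n with hD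
  have hD1 : ∀ k, D k = b * D (k + 1) := by
    intro k
    have hk := norm_mul_pow_le_one ha hq k
    have e1 := heineSeries_self hk hb.le hq
    have e2 := tsum_rogersFineTerm_rec hk hb hq
    rw [show a * q ^ k * q = a * q ^ (k + 1) by ring] at e1 e2
    simp only [hD]
    linear_combination e1 - e2
  have hD2 : ∀ k, D 0 = b ^ k * D k := by
    intro k
    induction k with
    | zero => simp
    | succ k ih => rw [ih, hD1 k]; ring
  obtain ⟨C, hC⟩ : ∃ C, ∀ k, ‖D k‖ ≤ C := by
    refine ⟨(∑' n, Real.exp (1 - ‖q‖)⁻¹ ^ 3 * ‖q‖ ^ n) +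
        ∑' n, ‖b‖ ^ n * Real.exp (1 - ‖q‖)⁻¹ ^ 2,
      fun k => (norm_sub_le _ _).trans (add_le_add ?_ ?_)⟩
    · exact tsum_of_norm_bounded
        ((summable_geometric_of_lt_one (norm_nonneg q) hq).mul_left _).hasSum
        (norm_heineCoeff_mul_pow_le (norm_mul_pow_le_one ha hq k) hb.le hq)
    · exact tsum_of_norm_bounded
        ((summable_geometric_of_lt_one (norm_nonneg b) hb).mul_right _).hasSum
        (norm_rogersFineTerm_le (norm_mul_pow_le_one ha hq k) hb.le hq)
  have h0 : D 0 = 0 := by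
    have hb1 := tendsto_pow_atTop_nhds_zero_of_lt_one (norm_nonneg b) hb
    refine norm_le_zero_iff.1 (ge_of_tendsto' (by simpa using hb1.mul_const C) fun k => ?_)
    rw [hD2 k, norm_mul, norm_pow]
    exact mul_le_mul_of_nonneg_left (hC k) (by positivity)
  simpa [hD, sub_eq_zero] using h0

lemma qPoch_ne_zero (ha : ‖a‖ < 1) (hq : ‖q‖ < 1) (n : ℕ) : qPoch a q n ≠ 0 := by
  refine Finset.prod_ne_zero_iff.2 fun j _ h => ?_
  have h1 : ‖a * q ^ j‖ < 1 := by
    rw [norm_mul, norm_pow]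
    exact mul_lt_one_of_nonneg_of_lt_one_left (norm_nonneg _) ha
      (pow_le_one₀ (norm_nonneg _) hq.le)
  rw [← sub_eq_zero.1 h, norm_one] at h1
  exact lt_irrefl _ h1

lemma qPochInf_mul_g3 (ha : ‖a‖ < 1) (hb : ‖b‖ < 1) (hq : ‖q‖ < 1) (hab : a * b = q)
    (hab' : a⁻¹ * q = b) :
    qPochInf a q * qPochInf b q * g3 a q = heineSeries a b q q := by
  rw [heineSeries_self_eq_tsum_rogersFineTerm ha.le hb hq, g3, ← tsum_mul_left]
  refine tsum_congr fun n => ?_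
  rw [hab', rogersFineTerm, hab, ← qPoch_mul_qPochInf a hq (n + 1),
    ← qPoch_mul_qPochInf b hq (n + 1), mul_div_assoc',
    div_eq_iff (mul_ne_zero (qPoch_ne_zero ha hq _) (qPoch_ne_zero hb hq _))]
  ring

/-- A null sequence satisfying a three-term recurrence which is a summable perturbation of
`w k = w (k + 1)` vanishes. -/
lemma eq_zero_of_three_term_rec {w : ℕ → ℂ} {ε : ℕ → ℝ} (hε : Summable ε) (hε0 : ∀ k, 0 ≤ ε k)
    (hw : ∀ k, ‖w k‖ ≤ (1 + ε k) * max ‖w (k + 1)‖ ‖w (k + 2)‖)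
    (h0 : Tendsto w atTop (𝓝 0)) (k : ℕ) : w k = 0 := by
  set M : ℕ → ℝ := fun k => max ‖w k‖ ‖w (k + 1)‖ with hM
  have hM0 : ∀ k, 0 ≤ M k := fun k => le_max_of_le_left (norm_nonneg _)
  have h1 : ∀ k, M k ≤ Real.exp (ε k) * M (k + 1) := by
    intro k
    have hk : 1 + ε k ≤ Real.exp (ε k) := by linarith [Real.add_one_le_exp (ε k)]
    refine max_le ((hw k).trans (mul_le_mul_of_nonneg_right hk (hM0 _))) ?_
    exact (le_max_left _ _).trans
      (le_mul_of_one_le_left (hM0 _) (Real.one_le_exp (hε0 k)))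
  have h2 : ∀ n, M k ≤ Real.exp (∑ i ∈ Finset.range n, ε (k + i)) * M (k + n) := by
    intro n
    induction n with
    | zero => simp
    | succ n ih =>
      rw [Finset.sum_range_succ, Real.exp_add, mul_assoc]
      exact ih.trans (mul_le_mul_of_nonneg_left (h1 _) (Real.exp_pos _).le)
  have h3 : ∀ n, M k ≤ Real.exp (∑' i, ε (k + i)) * M (k + n) := fun n =>
    (h2 n).trans (mul_le_mul_of_nonneg_right (Real.exp_le_exp.2
      (Summable.sum_le_tsum _ (fun _ _ => hε0 _)
        (hε.comp_injective (add_right_injective k)))) (hM0 _))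
  have h4 : Tendsto M atTop (𝓝 0) := by
    simpa using h0.norm.max ((tendsto_add_atTop_iff_nat 1).2 h0).norm
  have h5 : Tendsto (fun n => M (k + n)) atTop (𝓝 0) := by
    simpa only [add_comm] using (tendsto_add_atTop_iff_nat k).2 h4
  have h6 : M k ≤ 0 := ge_of_tendsto' (by simpa using h5.const_mul _) h3
  exact norm_le_zero_iff.1 ((le_max_left _ _).trans h6)

/-- Uniqueness of the normalised solution of the recurrence for partitions of Schur type. -/
lemma eq_heineSeries_of_rec {u : ℕ → ℂ} (ha : ‖a‖ ≤ 1) (hb : ‖b‖ ≤ 1) (hq : ‖q‖ < 1)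
    (hab : a * b = q) (hu : Tendsto u atTop (𝓝 1))
    (hrec : ∀ k, u k = (1 - (a + b) * q ^ k) * u (k + 1) +
      q ^ (k + 1) * (1 - q ^ (k + 1)) * u (k + 2)) :
    u 1 = heineSeries a b q q := by
  set w : ℕ → ℂ := fun k => qPoch q q k * u (k + 1) - heineSeries a b q (q ^ (k + 1)) with hw
  have hrw : ∀ k, (1 - q ^ (k + 1)) * w k =
      (1 - (a + b) * q ^ (k + 1)) * w (k + 1) + q ^ (k + 2) * w (k + 2) := by
    intro k
    have hx : ‖q ^ (k + 1)‖ < 1 := by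
      rw [norm_pow]; exact pow_lt_one₀ (norm_nonneg _) hq (Nat.succ_ne_zero k)
    have e1 := heineSeries_rec ha hb hq hx
    rw [hab, ← pow_succ, ← pow_add] at e1
    simp only [hw]
    rw [hrec (k + 1), qPoch_succ q q (k + 1), qPoch_succ q q k]
    linear_combination -e1
  have hw0 : Tendsto w atTop (𝓝 0) := by
    have := ((tendsto_qPoch q hq).mul ((tendsto_add_atTop_iff_nat 1).2 hu)).sub
      (tendsto_heineSeries ha hb hq)
    simpa using this
  set ρ := ‖q‖ with hρ
  have hρ0 : 0 ≤ ρ := norm_nonneg q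
  have hρ1 : 0 < 1 - ρ := sub_pos.2 hq
  have h0 := eq_zero_of_three_term_rec (w := w) (ε := fun k => 4 * (1 - ρ)⁻¹ * ρ ^ k)
    ((summable_geometric_of_lt_one hρ0 hq).mul_left _) (fun k => by positivity)
    (fun k => ?_) hw0 0
  · simpa [hw, qPoch_zero, sub_eq_zero] using h0
  set m := max ‖w (k + 1)‖ ‖w (k + 2)‖ with hm
  have hm0 : 0 ≤ m := le_max_of_le_left (norm_nonneg _)
  have hpk : ρ ^ (k + 1) ≤ ρ ^ k := pow_le_pow_of_le_one hρ0 hq.le (Nat.le_succ k)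
  have hpk1 : ρ ^ (k + 1) ≤ ρ := pow_le_of_le_one hρ0 hq.le (Nat.succ_ne_zero k)
  have hpk2 : ρ ^ (k + 2) ≤ ρ ^ (k + 1) := pow_le_pow_of_le_one hρ0 hq.le (Nat.le_succ _)
  have hlow : 1 - ρ ^ (k + 1) ≤ ‖1 - q ^ (k + 1)‖ := by
    have := norm_sub_norm_le (1 : ℂ) (q ^ (k + 1))
    rwa [norm_one, norm_pow] at this
  have hup1 : ‖1 - (a + b) * q ^ (k + 1)‖ ≤ 1 + 2 * ρ ^ (k + 1) := by
    refine (norm_sub_le _ _).trans ?_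
    rw [norm_one, norm_mul, norm_pow]
    have : ‖a + b‖ ≤ 2 := (norm_add_le _ _).trans (by linarith)
    gcongr
  have hup : (1 - ρ ^ (k + 1)) * ‖w k‖ ≤ (1 + 3 * ρ ^ (k + 1)) * m := by
    calc (1 - ρ ^ (k + 1)) * ‖w k‖ ≤ ‖(1 - q ^ (k + 1)) * w k‖ := by
          rw [norm_mul]; gcongr
      _ ≤ ‖1 - (a + b) * q ^ (k + 1)‖ * ‖w (k + 1)‖ + ρ ^ (k + 2) * ‖w (k + 2)‖ := by
          rw [hrw k]
          refine (norm_add_le _ _).trans_eq ?_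
          rw [norm_mul, norm_mul, norm_pow]
      _ ≤ (1 + 2 * ρ ^ (k + 1)) * m + ρ ^ (k + 1) * m := by
          gcongr
          · exact le_max_left _ _
          · exact le_max_right _ _
      _ = _ := by ring
  have hpos : 0 < 1 - ρ ^ (k + 1) := by linarith
  refine le_of_mul_le_mul_left (hup.trans ?_) hpos
  rw [← mul_assoc]
  refine mul_le_mul_of_nonneg_right ?_ hm0
  have h7 : 1 ≤ (1 - ρ ^ (k + 1)) * (1 - ρ)⁻¹ := by
    rw [← div_eq_mul_inv, le_div_iff₀ hρ1]; linarith
  have h8 : 0 ≤ ρ ^ k := by positivity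
  nlinarith [mul_le_mul_of_nonneg_right h7 h8]

end QSeries

section SchurPartitions

variable {d r m m' : ℕ} {q : ℂ}

/-- The partitions of Schur type all of whose parts are at least `m`. -/
def schurSet (d r m : ℕ) : Set (List ℕ) := {l | IsSchurPartition d r l ∧ ∀ x ∈ l, m ≤ x}

/-- The residue condition on the parts of a partition of Schur type. -/
def IsSchurPart (d r x : ℕ) : Prop := 0 < x ∧ (x % d = 0 ∨ x % d = r ∨ x % d = d - r)

lemma isSchurPartition_iff_pairwise (hd : 0 < d) (l : List ℕ) :
    IsSchurPartition d r l ↔ (∀ x ∈ l, IsSchurPart d r x) ∧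
      l.Pairwise (fun a b => b + d ≤ a ∧ (d ∣ a → b + d < a)) := by
  have : Trans (fun a b : ℕ => b + d ≤ a ∧ (d ∣ a → b + d < a))
      (fun a b : ℕ => b + d ≤ a ∧ (d ∣ a → b + d < a))
      (fun a b : ℕ => b + d ≤ a ∧ (d ∣ a → b + d < a)) :=
    ⟨fun h1 h2 => ⟨by omega, fun _ => by omega⟩⟩
  exact and_congr Iff.rfl List.isChain_iff_pairwise

lemma schurSet_congr (h : ∀ x, IsSchurPart d r x → (m ≤ x ↔ m' ≤ x)) :
    schurSet d r m = schurSet d r m' := by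
  ext l
  exact and_congr_right fun hl => forall₂_congr fun x hx => h x (hl.1 x hx)

lemma schurSet_eq_union (hd : 0 < d) (hm : IsSchurPart d r m)
    (h : ∀ x, IsSchurPart d r x → (m' ≤ x ↔ m + d ≤ x ∧ (d ∣ x → m + d < x))) :
    schurSet d r m = schurSet d r (m + 1) ∪ (fun l => l ++ [m]) '' schurSet d r m' := by
  ext l
  simp only [schurSet, isSchurPartition_iff_pairwise hd, Set.mem_union, Set.mem_image,
    Set.mem_ofPred_eq]
  constructor
  · rintro ⟨⟨hp, hc⟩, hl⟩
    rcases List.eq_nil_or_concat l with rfl | ⟨t, a, rfl⟩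
    · exact Or.inl (by simp)
    rw [List.concat_eq_append] at *
    simp only [List.pairwise_append, List.mem_append, List.mem_singleton, or_imp, forall_and,
      forall_eq] at hp hc hl
    obtain ⟨hct, -, hta⟩ := hc
    rcases hl.2.eq_or_lt with rfl | hma
    · refine Or.inr ⟨t, ⟨⟨hp.1, hct⟩, fun x hx => (h x (hp.1 x hx)).2 ⟨?_, ?_⟩⟩, rfl⟩
      · exact hta.1 x hx
      · exact hta.2 x hx
    · refine Or.inl ⟨⟨?_, ?_⟩, ?_⟩
      · simpa only [List.mem_append, List.mem_singleton, or_imp, forall_and, forall_eq] using hp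
      · simp only [List.pairwise_append, List.mem_singleton, forall_eq]
        exact ⟨hct, List.pairwise_singleton _ _,
          fun x hx => ⟨hta.1 x hx, hta.2 x hx⟩⟩
      · simp only [List.mem_append, List.mem_singleton, or_imp, forall_and, forall_eq]
        exact ⟨fun x hx => by have := hta.1 x hx; omega, hma⟩
  · rintro (⟨hp, hl⟩ | ⟨t, ⟨⟨hp, hc⟩, hl⟩, rfl⟩)
    · exact ⟨hp, fun x hx => (Nat.le_succ m).trans (hl x hx)⟩
    · have ht : ∀ x ∈ t, m + d ≤ x ∧ (d ∣ x → m + d < x) :=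
        fun x hx => (h x (hp x hx)).1 (hl x hx)
      refine ⟨⟨?_, ?_⟩, ?_⟩
      · simp only [List.mem_append, List.mem_singleton, or_imp, forall_and, forall_eq]
        exact ⟨hp, hm⟩
      · simp only [List.pairwise_append, List.mem_singleton, forall_eq]
        exact ⟨hc, List.pairwise_singleton _ _, ht⟩
      · simp only [List.mem_append, List.mem_singleton, or_imp, forall_and, forall_eq]
        exact ⟨fun x hx => by have := (ht x hx).1; omega, le_rfl⟩

lemma sortedGT_of_mem_schurSet (hd : 0 < d) {l : List ℕ} (hl : l ∈ schurSet d r m) :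
    l.Pairwise (· > ·) :=
  ((isSchurPartition_iff_pairwise hd l).1 hl.1).2.imp fun h => by omega

lemma summable_norm_pow_sum_schurSet (hd : 0 < d) (hq : ‖q‖ < 1) (m : ℕ) :
    Summable fun l : schurSet d r m => ‖q ^ (l : List ℕ).sum‖ := by
  have h1 := summable_finsetProd_of_summable_nonneg (f := fun n : ℕ => ‖q‖ ^ n)
    (fun n => by positivity) (summable_geometric_of_lt_one (norm_nonneg q) hq)
  have hnd : ∀ l : schurSet d r m, (l : List ℕ).Nodup := fun l =>
    (sortedGT_of_mem_schurSet hd l.2).imp fun h => by omega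
  have hinj : Function.Injective fun l : schurSet d r m => (l : List ℕ).toFinset := by
    intro l₁ l₂ h
    refine Subtype.ext (List.Perm.eq_of_pairwise (le := (· > ·)) (fun a b _ _ h₁ h₂ => by omega)
      (sortedGT_of_mem_schurSet hd l₁.2) (sortedGT_of_mem_schurSet hd l₂.2)
      (List.perm_of_nodup_nodup_toFinset_eq (hnd l₁) (hnd l₂) h))
  refine (h1.comp_injective hinj).congr fun l => ?_
  simp only [Function.comp_apply]
  rw [Finset.prod_pow_eq_pow_sum, List.sum_toFinset _ (hnd l), List.map_id', norm_pow]

/-- The generating function of the partitions of Schur type with all parts at least `m`. -/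
noncomputable def schurGF (d r : ℕ) (q : ℂ) (m : ℕ) : ℂ :=
  ∑' l : schurSet d r m, q ^ (l : List ℕ).sum

lemma summable_schurGF (hd : 0 < d) (hq : ‖q‖ < 1) (m : ℕ) :
    Summable fun l : schurSet d r m => q ^ (l : List ℕ).sum :=
  (summable_norm_pow_sum_schurSet hd hq m).of_norm

lemma schurGF_congr (h : ∀ x, IsSchurPart d r x → (m ≤ x ↔ m' ≤ x)) :
    schurGF d r q m = schurGF d r q m' := by
  rw [schurGF, schurGF, schurSet_congr h]

lemma schurGF_eq_add (hd : 0 < d) (hq : ‖q‖ < 1) (hm : IsSchurPart d r m)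
    (h : ∀ x, IsSchurPart d r x → (m' ≤ x ↔ m + d ≤ x ∧ (d ∣ x → m + d < x))) :
    schurGF d r q m = schurGF d r q (m + 1) + q ^ m * schurGF d r q m' := by
  have hu := schurSet_eq_union hd hm h
  have hinj : Function.Injective fun l : List ℕ => l ++ [m] := List.append_left_injective [m]
  have hdisj : Disjoint (schurSet d r (m + 1)) ((fun l => l ++ [m]) '' schurSet d r m') := by
    rw [Set.disjoint_left]
    rintro _ hl ⟨t, -, rfl⟩
    have := hl.2 m (by simp)
    omega
  have hs : Summable fun l : (fun l : List ℕ => l ++ [m]) '' schurSet d r m' =>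
      q ^ (l : List ℕ).sum := by
    have hsub : (fun l : List ℕ => l ++ [m]) '' schurSet d r m' ⊆ schurSet d r m := by
      rw [hu]; exact Set.subset_union_right
    exact ((summable_schurGF hd hq m).comp_injective
      (Set.inclusion_injective hsub) :)
  rw [schurGF, hu, Summable.tsum_union_disjoint (f := fun l : List ℕ => q ^ l.sum) hdisj
    (summable_schurGF hd hq (m + 1)) hs,
    tsum_image (fun l : List ℕ => q ^ l.sum) hinj.injOn, schurGF, schurGF, ← tsum_mul_left]
  congr 1
  refine tsum_congr fun l => ?_
  rw [List.sum_append, List.sum_singleton, pow_add, mul_comm]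

lemma tendsto_schurGF (hd : 0 < d) (hq : ‖q‖ < 1) :
    Tendsto (schurGF d r q) atTop (𝓝 1) := by
  classical
  have hnil : ([] : List ℕ) ∈ schurSet d r 0 :=
    ⟨(isSchurPartition_iff_pairwise hd _).2 (by simp), by simp⟩
  have hlim : ∑' l : schurSet d r 0, (if (l : List ℕ) = [] then (1 : ℂ) else 0) = 1 := by
    rw [tsum_eq_single ⟨[], hnil⟩ fun l hl => if_neg fun h => hl (Subtype.ext h)]
    simp
  have heq : ∀ m, schurGF d r q m = ∑' l : schurSet d r 0,
      if ∀ x ∈ (l : List ℕ), m ≤ x then q ^ (l : List ℕ).sum else 0 := by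
    intro m
    rw [schurGF, tsum_subtype (schurSet d r m) fun l => q ^ l.sum,
      tsum_subtype (schurSet d r 0) fun l => if ∀ x ∈ l, m ≤ x then q ^ l.sum else 0]
    refine tsum_congr fun l => ?_
    simp only [Set.indicator, schurSet, Set.mem_ofPred_eq, zero_le, implies_true, and_true]
    by_cases h1 : IsSchurPartition d r l <;> by_cases h2 : ∀ x ∈ l, m ≤ x <;> simp [h1, h2]
  rw [← hlim, funext heq]
  refine tendsto_tsum_of_dominated_convergence (summable_norm_pow_sum_schurSet hd hq 0)
    (fun l => ?_) (Eventually.of_forall fun m l => ?_)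
  · rcases eq_or_ne (l : List ℕ) [] with h | h
    · simp [h]
    · obtain ⟨x, hx⟩ := List.exists_mem_of_ne_nil _ h
      refine tendsto_const_nhds.congr' ?_
      filter_upwards [eventually_gt_atTop x] with m hm
      rw [if_neg h, if_neg fun h' => absurd (h' x hx) (by omega)]
  · split_ifs
    · exact le_rfl
    · simp

lemma schurCGen_eq_schurGF (hd : 0 < d) (hq : ‖q‖ < 1) :
    schurCGen d r q = schurGF d r q (d + 1) := by
  have h := (summable_schurGF (r := r) hd hq (d + 1)).hasSum.tsum_fiberwise
    fun l : schurSet d r (d + 1) => (l : List ℕ).sum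
  rw [schurGF, ← h.tsum_eq, schurCGen]
  refine tsum_congr fun n => ?_
  have hn : ∀ l : (fun l : schurSet d r (d + 1) => (l : List ℕ).sum) ⁻¹' {n},
      q ^ ((l : schurSet d r (d + 1)) : List ℕ).sum = q ^ n := fun l => by
    rw [show ((l : schurSet d r (d + 1)) : List ℕ).sum = n from l.2]
  rw [tsum_congr hn, tsum_const, nsmul_eq_mul, Nat.card_coe_set_eq, schurC,
    ← Set.ncard_image_of_injective _ Subtype.val_injective]
  congr 3
  ext l
  simp only [schurSet, Set.mem_image, Set.mem_preimage, Set.mem_singleton_iff, Subtype.exists,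
    Set.mem_ofPred_eq, exists_and_left, exists_prop, exists_eq_right_right, Nat.succ_le_iff]
  tauto

lemma IsSchurPart.exists_eq (hd : 0 < d) {x : ℕ} (hx : IsSchurPart d r x) (k : ℕ) :
    ∃ c s, x = c + s ∧ (c + d ≤ k * d ∨ c = k * d ∨ c = k * d + d ∨ k * d + 2 * d ≤ c) ∧
      s < d ∧ (s = 0 ∨ s = r ∨ s = d - r) ∧ (d ∣ x ↔ s = 0) := by
  refine ⟨d * (x / d), x % d, (Nat.div_add_mod x d).symm, ?_, Nat.mod_lt _ hd, hx.2,
    Nat.dvd_iff_mod_eq_zero⟩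
  rw [mul_comm d]
  generalize x / d = c
  rcases lt_trichotomy c k with h | rfl | h
  · exact Or.inl (by nlinarith)
  · exact Or.inr (Or.inl rfl)
  · rcases Nat.eq_or_lt_of_le h with rfl | h
    · exact Or.inr (Or.inr (Or.inl (by simp [add_mul])))
    · exact Or.inr (Or.inr (Or.inr (by nlinarith)))

lemma schurGF_rec (hr1 : 1 ≤ r) (hr2 : 2 * r < d) (hq : ‖q‖ < 1) (k : ℕ) :
    schurGF d r q (k * d + 1) =
      (1 + (q ^ r + q ^ (d - r)) * (q ^ d) ^ k) * schurGF d r q ((k + 1) * d + 1) +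
        (q ^ d) ^ (k + 1) * (1 - (q ^ d) ^ (k + 1)) * schurGF d r q ((k + 2) * d + 1) := by
  have hd : 0 < d := by omega
  have first : ∀ k, schurGF d r q (k * d + 1) = schurGF d r q (k * d + (d - r)) +
      q ^ (k * d + r) * schurGF d r q ((k + 1) * d + 1) := by
    intro k
    rw [schurGF_congr (m := k * d + 1) (m' := k * d + r),
      schurGF_eq_add (m' := (k + 1) * d + 1) hd hq,
      schurGF_congr (m := k * d + r + 1) (m' := k * d + (d - r))]
    · intro x hx
      obtain ⟨c, s, rfl, hc, hs, hs', -⟩ := hx.exists_eq hd k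
      omega
    · exact ⟨by omega, by
        rw [Nat.mul_add_mod', Nat.mod_eq_of_lt (by omega)]; omega⟩
    · intro x hx
      obtain ⟨c, s, rfl, hc, hs, hs', hdvd⟩ := hx.exists_eq hd k
      rw [hdvd, add_mul, one_mul]
      omega
    · intro x hx
      obtain ⟨c, s, rfl, hc, hs, hs', -⟩ := hx.exists_eq hd k
      omega
  have second : ∀ k, schurGF d r q (k * d + (d - r)) = schurGF d r q (k * d + d) +
      q ^ (k * d + (d - r)) * schurGF d r q ((k + 1) * d + (d - r)) := by
    intro k
    rw [schurGF_eq_add (m' := (k + 1) * d + (d - r)) hd hq,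
      schurGF_congr (m := k * d + (d - r) + 1) (m' := k * d + d)]
    · intro x hx
      obtain ⟨c, s, rfl, hc, hs, hs', -⟩ := hx.exists_eq hd k
      omega
    · exact ⟨by omega, by
        rw [Nat.mul_add_mod', Nat.mod_eq_of_lt (by omega)]; omega⟩
    · intro x hx
      obtain ⟨c, s, rfl, hc, hs, hs', hdvd⟩ := hx.exists_eq hd k
      rw [hdvd, add_mul, one_mul]
      omega
  have third : schurGF d r q (k * d + d) = schurGF d r q ((k + 1) * d + 1) +
      q ^ (k * d + d) * schurGF d r q ((k + 2) * d + 1) := by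
    rw [schurGF_eq_add (m' := (k + 2) * d + 1) hd hq, add_mul k 1, one_mul]
    · exact ⟨by omega, by simp⟩
    · intro x hx
      obtain ⟨c, s, rfl, hc, hs, hs', hdvd⟩ := hx.exists_eq hd k
      rw [hdvd, add_mul]
      omega
  have e1 := first k
  have e2 := first (k + 1)
  have hqd : q ^ d = q ^ r * q ^ (d - r) := by rw [← pow_add]; congr 1; omega
  have hqk : ∀ j, q ^ (j * d) = (q ^ d) ^ j := fun j => by rw [mul_comm, pow_mul]
  rw [second k, third] at e1
  simp only [pow_add, hqk] at e1 e2 ⊢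
  rw [add_assoc k 1 1] at e2
  norm_num only at e2
  rw [hqd] at *
  linear_combination e1 - q ^ (d - r) * (q ^ r * q ^ (d - r)) ^ k * e2

end SchurPartitions

/-- `𝒞_{d,r}(q) = (-q^r; q^d)_∞ (-q^{d-r}; q^d)_∞ · g₃(-q^r; q^d)`. -/
theorem schurCGen_eq_g3 (d r : ℕ) (hd : 3 ≤ d) (hr1 : 1 ≤ r) (hr2 : 2 * r < d)
    (q : ℂ) (hq : ‖q‖ < 1) :
    schurCGen d r q =
      qPochInf (-q ^ r) (q ^ d) * qPochInf (-q ^ (d - r)) (q ^ d) * g3 (-q ^ r) (q ^ d) := by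
  have hd0 : 0 < d := by omega
  have hpow : ∀ n : ℕ, n ≠ 0 → ‖-q ^ n‖ < 1 := fun n hn => by
    rw [norm_neg, norm_pow]; exact pow_lt_one₀ (norm_nonneg _) hq hn
  have ha := hpow r (by omega)
  have hb := hpow (d - r) (by omega)
  have hQ : ‖q ^ d‖ < 1 := by simpa using hpow d (by omega)
  have hqd : q ^ d = q ^ r * q ^ (d - r) := by rw [← pow_add]; congr 1; omega
  have hab' : (-q ^ r)⁻¹ * q ^ d = -q ^ (d - r) := by
    rcases eq_or_ne q 0 with rfl | h0
    · simp [hd0.ne', show d - r ≠ 0 by omega]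
    · rw [hqd, inv_neg, neg_mul, inv_mul_cancel_left₀ (pow_ne_zero r h0)]
  have hlim : Tendsto (fun k => schurGF d r q (k * d + 1)) atTop (𝓝 1) :=
    (tendsto_schurGF hd0 hq).comp
      (tendsto_atTop_mono (fun k => (Nat.le_mul_of_pos_right k hd0).trans (Nat.le_succ _)) tendsto_id)
  rw [qPochInf_mul_g3 ha hb hQ (by rw [hqd]; ring) hab', schurCGen_eq_schurGF hd0 hq,
    ← eq_heineSeries_of_rec (u := fun k => schurGF d r q (k * d + 1)) ha.le hb.le hQ
      (by rw [hqd]; ring) hlim fun k => (schurGF_rec hr1 hr2 hq k).trans (by ring)]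
  simp only [one_mul]
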